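/- For the symmetric set I = [-A,-1] ∪ [1,A], the best approximation errors satisfy lim_{m→∞} √(2m+1) · ((A+1)/(A−1))^m · (√A/(A−1)) · L_{2m+1} = √(2/π); equivalently, L_{2m+1} ~ (√2·(A−1)/√(πA)) · (2m+1)^{-1/2} · ((A−1)/(A+1))^m as m → ∞. -/

import Mathlib

open MeasureTheory Filter Set Real

/-- sign function: -1 for negative, 1 otherwise (only used on sets avoiding 0) -/
noncomputable def sgn (x : ℝ) : ℝ := if x < 0 then -1 else 1

/-- The error of best uniform approximation of sgn on [-A,-1] ∪ [1,B]
by real polynomials of degree at most n. -/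
noncomputable def bestErr (A B : ℝ) (n : ℕ) : ℝ :=
  sInf {e : ℝ | ∃ p : Polynomial ℝ, p.degree ≤ (n : ℕ) ∧
    e = sSup ((fun x => |sgn x - p.eval x|) '' (Icc (-A) (-1) ∪ Icc 1 B))}

/-- the weight w(x) = ((1−x²)(x+A)(B−x))^(−1/2) -/
noncomputable def wt (A B x : ℝ) : ℝ := 1 / Real.sqrt ((1 - x ^ 2) * (x + A) * (B - x))

/-- the critical point C of the Green function -/
noncomputable def Ccrit (A B : ℝ) : ℝ :=
  (∫ x in (-1 : ℝ)..1, x * wt A B x) / (∫ x in (-1 : ℝ)..1, wt A B x)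

/-- η = G(C,∞), the critical value of the Green function -/
noncomputable def eta (A B : ℝ) : ℝ :=
  ∫ x in (-1 : ℝ)..(Ccrit A B), (Ccrit A B - x) * wt A B x


noncomputable def uu : ℕ → ℝ
  | 0 => 1
  | (k+1) => uu k * ((2 * k + 1) / (2 * k + 2))

lemma uu_succ (k : ℕ) : uu (k+1) = uu k * ((2 * k + 1) / (2 * k + 2)) := rfl

lemma uu_pos (k : ℕ) : 0 < uu k := by
  induction k with
  | zero => simp [uu]
  | succ k ih => rw [uu_succ]; positivity

lemma uu_succ_le (k : ℕ) : uu (k+1) ≤ uu k := by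
  rw [uu_succ]
  apply mul_le_of_le_one_right (uu_pos k).le
  rw [div_le_one (by positivity)]; linarith

lemma uu_anti : Antitone uu := antitone_nat_of_succ_le uu_succ_le

lemma uu_le_one (k : ℕ) : uu k ≤ 1 := by
  have := uu_anti (Nat.zero_le k)
  simpa [uu] using this

lemma uu_wallis (k : ℕ) : (2 * k + 1) * uu k ^ 2 * Real.Wallis.W k = 1 := by
  induction k with
  | zero => simp [uu, Real.Wallis.W]
  | succ k ih =>
    rw [Real.Wallis.W_succ, uu_succ]
    refine Eq.trans ?_ ih
    push_cast
    field_simp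
    ring

lemma uu_sqrt (k : ℕ) : √(2 * k + 1) * uu k = √((Real.Wallis.W k)⁻¹) := by
  have h := uu_wallis k
  have hW := Real.Wallis.W_pos k
  have : (Real.Wallis.W k)⁻¹ = (2 * k + 1) * uu k ^ 2 := by
    field_simp; linarith
  rw [this, Real.sqrt_mul (by positivity), Real.sqrt_sq (uu_pos k).le]

lemma uu_tendsto : Tendsto (fun k : ℕ => √(2 * k + 1) * uu k) atTop (nhds √(2 / π)) := by
  simp_rw [uu_sqrt]
  have h := (Real.Wallis.tendsto_W_nhds_pi_div_two.inv₀ (by positivity)).sqrt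
  simpa [inv_div] using h

lemma uu_bound (m : ℕ) : √(2 * m + 1) * uu m ≤ 1 := by
  induction m with
  | zero => simp [uu]
  | succ k ih =>
    have h0 := uu_pos k
    have h1 : (√(2 * k + 1) * uu k)^2 ≤ 1 := pow_le_one₀ (by positivity) ih
    rw [mul_pow, Real.sq_sqrt (by positivity)] at h1
    rw [uu_succ]
    apply abs_le_one_iff_mul_self_le_one.2 _ |> (le_abs_self _).trans
    rw [← sq, mul_pow, Real.sq_sqrt (by positivity), mul_pow]
    push_cast
    have : (2 * ((k:ℝ) + 1) + 1) * (uu k ^ 2 * ((2 * k + 1) / (2 * k + 2)) ^ 2)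
      = ((2 * k + 1) * uu k ^ 2) * ((2 * k + 3) * (2 * k + 1) / (2 * k + 2) ^ 2) := by
      field_simp; ring
    rw [this]
    apply mul_le_one₀ h1 (by positivity)
    rw [div_le_one (by positivity)]; nlinarith

lemma uu_shift_tendsto (c : ℕ) :
    Tendsto (fun m : ℕ => √(2 * m + 1) * uu (m + c)) atTop (nhds √(2 / π)) := by
  induction c with
  | zero => simpa using uu_tendsto
  | succ c ih =>
    have h1 : Tendsto (fun m : ℕ => (1:ℝ) - 1 / (2 * ((m + c : ℕ):ℝ) + 2)) atTop (nhds (1 - 0)) := by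
      apply Tendsto.sub tendsto_const_nhds
      simp_rw [one_div]
      apply Tendsto.inv_tendsto_atTop
      apply tendsto_atTop_add_const_right
      apply Tendsto.const_mul_atTop (by norm_num)
      exact tendsto_natCast_atTop_atTop.comp (tendsto_add_atTop_nat c)
    have h2 := ih.mul h1
    rw [sub_zero, mul_one] at h2
    refine h2.congr fun m => ?_
    rw [← add_assoc, uu_succ, mul_assoc]
    congr 2
    field_simp
    ring

lemma uu_conv (n : ℕ) : ∑ p ∈ Finset.HasAntidiagonal.antidiagonal n, uu p.1 * uu p.2 = 1 := by
  have hT : ∀ n : ℕ, 2 * ∑ p ∈ Finset.HasAntidiagonal.antidiagonal n, (p.1 : ℝ) * (uu p.1 * uu p.2)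
      = n * ∑ p ∈ Finset.HasAntidiagonal.antidiagonal n, uu p.1 * uu p.2 := by
    intro n
    have h := Finset.Nat.sum_antidiagonal_swap (n := n) (f := fun p => (p.1 : ℝ) * (uu p.1 * uu p.2))
    rw [two_mul]
    nth_rewrite 1 [← h]
    rw [← Finset.sum_add_distrib, Finset.mul_sum]
    apply Finset.sum_congr rfl
    intro p hp
    have : p.1 + p.2 = n := by simpa using hp
    rw [← this]
    simp only [Prod.fst_swap, Prod.snd_swap]
    push_cast
    ring
  induction n with
  | zero => simp [uu]
  | succ n ih =>
    have h1 := hT (n+1)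
    rw [Finset.Nat.sum_antidiagonal_succ] at h1
    have h2 : ∑ p ∈ Finset.HasAntidiagonal.antidiagonal n, ((p.1 + 1 : ℕ) : ℝ) * (uu (p.1+1) * uu p.2)
       = ∑ p ∈ Finset.HasAntidiagonal.antidiagonal n, (p.1 : ℝ) * (uu p.1 * uu p.2)
        + 1/2 * ∑ p ∈ Finset.HasAntidiagonal.antidiagonal n, uu p.1 * uu p.2 := by
      rw [Finset.mul_sum, ← Finset.sum_add_distrib]
      apply Finset.sum_congr rfl
      intro p _
      rw [uu_succ]
      push_cast
      field_simp
    simp only [Nat.cast_zero, zero_mul, zero_add] at h1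
    rw [h2, mul_add, hT n, ih] at h1
    have h3 : ((n:ℝ) + 1) * ∑ p ∈ Finset.HasAntidiagonal.antidiagonal (n+1), uu p.1 * uu p.2 = (n + 1) * 1 := by
      push_cast at h1
      linarith
    exact mul_left_cancel₀ (by positivity) h3

lemma summable_uu_norm (w : ℂ) (hw : ‖w‖ < 1) : Summable fun k => ‖(uu k : ℂ) * w ^ k‖ := by
  refine Summable.of_nonneg_of_le (fun _ => norm_nonneg _) (fun k => ?_)
    (summable_geometric_of_lt_one (norm_nonneg w) hw)
  rw [norm_mul, norm_pow, Complex.norm_real, Real.norm_of_nonneg (uu_pos k).le]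
  exact mul_le_of_le_one_left (by positivity) (uu_le_one k)

lemma uu_sq (w : ℂ) (hw : ‖w‖ < 1) :
    (∑' k, (uu k : ℂ) * w ^ k) * (∑' k, (uu k : ℂ) * w ^ k) = (1 - w)⁻¹ := by
  rw [tsum_mul_tsum_eq_tsum_sum_antidiagonal_of_summable_norm (summable_uu_norm w hw)
    (summable_uu_norm w hw), ← tsum_geometric_of_norm_lt_one hw]
  congr 1; ext n
  have : ∀ p ∈ Finset.HasAntidiagonal.antidiagonal n, (uu p.1 : ℂ) * w ^ p.1 * ((uu p.2 : ℂ) * w ^ p.2)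
      = ((uu p.1 * uu p.2 : ℝ) : ℂ) * w ^ n := by
    intro p hp
    have : p.1 + p.2 = n := by simpa using hp
    rw [← this, pow_add]; push_cast; ring
  rw [Finset.sum_congr rfl this, ← Finset.sum_mul, ← Complex.ofReal_sum, uu_conv]
  simp

noncomputable def dd (r : ℝ) (j : ℕ) : ℝ := ∑' l : ℕ, uu l * uu (l + j) * r ^ (2 * l)

lemma uu_mul_le (k l : ℕ) : uu k * uu l ≤ 1 :=
  mul_le_one₀ (uu_le_one k) (uu_pos l).le (uu_le_one l)

lemma summable_r2 (r : ℝ) (h0 : 0 ≤ r) (h1 : r < 1) : Summable fun l : ℕ => r ^ (2 * l) := by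
  simp_rw [pow_mul]
  exact summable_geometric_of_lt_one (by positivity) (by nlinarith)

lemma summable_dd (r : ℝ) (h0 : 0 ≤ r) (h1 : r < 1) (j : ℕ) :
    Summable fun l : ℕ => uu l * uu (l + j) * r ^ (2 * l) := by
  refine Summable.of_nonneg_of_le (fun l => ?_) (fun k => ?_) (summable_r2 r h0 h1)
  · have := uu_pos l; have := uu_pos (l+j); positivity
  · exact mul_le_of_le_one_left (by positivity) (uu_mul_le _ _)

lemma dd_anti (r : ℝ) (h0 : 0 ≤ r) (h1 : r < 1) : Antitone (dd r) := by
  intro i j hij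
  apply Summable.tsum_le_tsum _ (summable_dd r h0 h1 j) (summable_dd r h0 h1 i)
  intro l
  have := uu_pos l
  have := uu_anti (show l + i ≤ l + j by omega)
  gcongr

lemma dd_nonneg (r : ℝ) (h0 : 0 ≤ r) (j : ℕ) : 0 ≤ dd r j := by
  apply tsum_nonneg
  intro l
  have := uu_pos l; have := uu_pos (l+j); positivity

lemma uu_real_sum (r : ℝ) (h0 : 0 ≤ r) (h1 : r < 1) :
    ∑' l : ℕ, uu l * r ^ (2 * l) = (√(1 - r ^ 2))⁻¹ := by
  have hw : ‖((r ^ 2 : ℝ) : ℂ)‖ < 1 := by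
    rw [Complex.norm_real, Real.norm_of_nonneg (by positivity)]; nlinarith
  have h := uu_sq _ hw
  have e : (∑' k, (uu k : ℂ) * ((r ^ 2 : ℝ) : ℂ) ^ k) = ((∑' l : ℕ, uu l * r ^ (2 * l) : ℝ) : ℂ) := by
    rw [Complex.ofReal_tsum]
    congr 1; ext k
    push_cast; rw [pow_mul]
  rw [e] at h
  have h' : (∑' l : ℕ, uu l * r ^ (2 * l)) * (∑' l : ℕ, uu l * r ^ (2 * l)) = (1 - r ^ 2)⁻¹ := by
    exact_mod_cast h
  have hp : 0 ≤ ∑' l : ℕ, uu l * r ^ (2 * l) := by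
    apply tsum_nonneg
    intro l
    have := uu_pos l; positivity
  rw [← Real.sqrt_inv, ← h', Real.sqrt_mul_self hp]

lemma sqrt_uu_le (m c : ℕ) : √(2 * m + 1) * uu (m + c) ≤ 1 :=
  (mul_le_mul_of_nonneg_left (uu_anti (Nat.le_add_right m c)) (Real.sqrt_nonneg _)).trans (uu_bound m)

lemma dd_tendsto (r : ℝ) (h0 : 0 ≤ r) (h1 : r < 1) (c : ℕ) :
    Tendsto (fun m : ℕ => √(2 * m + 1) * dd r (m + c)) atTop
      (nhds (√(2 / π) * (√(1 - r ^ 2))⁻¹)) := by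
  have := tendsto_tsum_of_dominated_convergence (𝓕 := atTop)
    (f := fun (m : ℕ) (l : ℕ) => √(2 * m + 1) * (uu l * uu (l + (m + c)) * r ^ (2 * l)))
    (g := fun l => √(2 / π) * (uu l * r ^ (2 * l)))
    (summable_r2 r h0 h1) (fun l => ?_) (Eventually.of_forall fun m l => ?_)
  · rw [tsum_mul_left, uu_real_sum r h0 h1] at this
    simpa only [tsum_mul_left, dd] using this
  · refine ((uu_shift_tendsto (c + l)).mul_const (uu l * r ^ (2 * l))).congr fun m => ?_
    rw [show l + (m + c) = m + (c + l) by ring]; ring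
  · have a := uu_pos l
    have b := uu_pos (m + (c + l))
    have e := sqrt_uu_le m (c + l)
    rw [show l + (m + c) = m + (c + l) by ring, Real.norm_of_nonneg (by positivity)]
    calc √(2 * m + 1) * (uu l * uu (m + (c + l)) * r ^ (2 * l))
       = (√(2 * m + 1) * uu (m + (c + l))) * uu l * r ^ (2 * l) := by ring
     _ ≤ 1 * 1 * r ^ (2 * l) := by
        have := uu_le_one l
        gcongr
     _ = _ := by ring

lemma sqrt_dd_le (r : ℝ) (h0 : 0 ≤ r) (h1 : r < 1) (m c : ℕ) :
    √(2 * m + 1) * dd r (m + c) ≤ ∑' l : ℕ, r ^ (2 * l) := by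
  rw [dd, ← tsum_mul_left]
  refine Summable.tsum_le_tsum (fun l => ?_) ((summable_dd r h0 h1 _).mul_left _) (summable_r2 r h0 h1)
  have a := uu_pos l
  have e := sqrt_uu_le m (c + l)
  rw [show l + (m + c) = m + (c + l) by ring]
  have b := uu_pos (m + (c + l))
  calc √(2 * m + 1) * (uu l * uu (m + (c + l)) * r ^ (2 * l))
       = (√(2 * m + 1) * uu (m + (c + l))) * uu l * r ^ (2 * l) := by ring
     _ ≤ 1 * 1 * r ^ (2 * l) := by
        have := uu_le_one l
        gcongr
     _ = _ := by ring

noncomputable def del (r : ℝ) (m : ℕ) : ℝ := ∑' k : ℕ, r ^ k * (dd r (m + 1) - dd r (m + 1 + k))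

lemma summable_del (r : ℝ) (h0 : 0 ≤ r) (h1 : r < 1) (m : ℕ) :
    Summable fun k : ℕ => r ^ k * (dd r (m + 1) - dd r (m + 1 + k)) := by
  refine Summable.of_nonneg_of_le (fun k => ?_) (fun k => ?_)
    ((summable_geometric_of_lt_one h0 h1).mul_right (dd r (m+1)))
  · have := dd_anti r h0 h1 (show m + 1 ≤ m + 1 + k by omega)
    exact mul_nonneg (by positivity) (by linarith)
  · have := dd_nonneg r h0 (m + 1 + k)
    gcongr; linarith

lemma del_tendsto (r : ℝ) (h0 : 0 ≤ r) (h1 : r < 1) :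
    Tendsto (fun m : ℕ => √(2 * m + 1) * del r m) atTop (nhds 0) := by
  have := tendsto_tsum_of_dominated_convergence (𝓕 := atTop)
    (f := fun (m : ℕ) (k : ℕ) => √(2 * m + 1) * (r ^ k * (dd r (m + 1) - dd r (m + 1 + k))))
    (g := fun l => 0) (bound := fun k => r ^ k * ∑' l : ℕ, r ^ (2 * l))
    ((summable_geometric_of_lt_one h0 h1).mul_right _) (fun k => ?_)
    (Eventually.of_forall fun m k => ?_)
  · simpa only [tsum_mul_left, del, tsum_zero] using this
  · have := ((dd_tendsto r h0 h1 1).sub (dd_tendsto r h0 h1 (1 + k))).const_mul (r ^ k)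
    rw [sub_self, mul_zero] at this
    refine this.congr fun m => ?_
    rw [← add_assoc]; ring
  · have a := dd_anti r h0 h1 (show m + 1 ≤ m + 1 + k by omega)
    have b := dd_nonneg r h0 (m + 1 + k)
    have e := sqrt_dd_le r h0 h1 m 1
    have : 0 ≤ r ^ k * (dd r (m + 1) - dd r (m + 1 + k)) := mul_nonneg (by positivity) (by linarith)
    rw [Real.norm_of_nonneg (by positivity)]
    calc √(2 * m + 1) * (r ^ k * (dd r (m + 1) - dd r (m + 1 + k)))
        ≤ √(2 * m + 1) * (r ^ k * dd r (m + 1)) := by gcongr; linarith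
      _ = r ^ k * (√(2 * m + 1) * dd r (m + 1)) := by ring
      _ ≤ _ := by gcongr

lemma my_hasSum_congr {f g : ℕ → ℝ} {a : ℝ} (h : ∀ x, f x = g x) : HasSum f a ↔ HasSum g a := by
  rw [funext h]

noncomputable def ss (r θ : ℝ) : ℝ := √(1 - 2 * r * cos θ + r ^ 2)

noncomputable def ww (r θ : ℝ) : ℂ := (r : ℂ) * Complex.exp (θ * Complex.I)

lemma norm_ww (r θ : ℝ) (h0 : 0 ≤ r) : ‖ww r θ‖ = r := by
  rw [ww, norm_mul, Complex.norm_exp_ofReal_mul_I, Complex.norm_real, Real.norm_of_nonneg h0, mul_one]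

lemma ww_re (r θ : ℝ) : (ww r θ).re = r * cos θ := by
  simp [ww, Complex.exp_ofReal_mul_I_re]

lemma ww_im (r θ : ℝ) : (ww r θ).im = r * sin θ := by
  simp [ww, Complex.exp_ofReal_mul_I_im]

lemma norm_one_sub_ww (r θ : ℝ) : ‖1 - ww r θ‖ = ss r θ := by
  rw [Complex.norm_def, ss, Complex.normSq_apply]
  congr 1
  simp only [Complex.sub_re, Complex.sub_im, ww_re, ww_im, Complex.one_re, Complex.one_im]
  have := Real.sin_sq_add_cos_sq θ
  linear_combination r ^ 2 * this

lemma ss_pos (r θ : ℝ) (h0 : 0 ≤ r) (h1 : r < 1) : 0 < ss r θ := by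
  rw [← norm_one_sub_ww, norm_pos_iff, sub_ne_zero]
  intro h
  have := norm_ww r θ h0
  rw [← h, norm_one] at this
  linarith

lemma ss_le (r θ : ℝ) (h0 : 0 ≤ r) (h1 : r < 1) : ss r θ ≤ 2 := by
  rw [← norm_one_sub_ww]
  refine (norm_sub_le _ _).trans ?_
  rw [norm_ww r θ h0, norm_one]; linarith

lemma ww_pow_re (r θ : ℝ) (k : ℕ) : (ww r θ ^ k).re = r ^ k * cos (k * θ) := by
  rw [ww, mul_pow, ← Complex.exp_nat_mul, ← Complex.ofReal_pow, Complex.re_ofReal_mul, ← mul_assoc]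
  have : ((k : ℂ) * (θ : ℂ)) = ((k * θ : ℝ) : ℂ) := by push_cast; ring
  rw [this, Complex.exp_ofReal_mul_I_re]

lemma ww_pow_im (r θ : ℝ) (k : ℕ) : (ww r θ ^ k).im = r ^ k * sin (k * θ) := by
  rw [ww, mul_pow, ← Complex.exp_nat_mul, ← Complex.ofReal_pow, Complex.im_ofReal_mul, ← mul_assoc]
  have : ((k : ℂ) * (θ : ℂ)) = ((k * θ : ℝ) : ℂ) := by push_cast; ring
  rw [this, Complex.exp_ofReal_mul_I_im]

noncomputable def ff (r θ : ℝ) (p : ℕ × ℕ) : ℝ :=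
  uu p.1 * uu p.2 * r ^ (p.1 + p.2) * cos (((p.1 : ℝ) - p.2) * θ)

lemma ff_eq (r θ : ℝ) (p : ℕ × ℕ) : ff r θ p =
    (((uu p.1 : ℂ) * ww r θ ^ p.1) * (starRingEnd ℂ) ((uu p.2 : ℂ) * ww r θ ^ p.2)).re := by
  simp only [Complex.mul_re, Complex.conj_re, Complex.conj_im, Complex.ofReal_re,
    Complex.ofReal_im, Complex.mul_im, ww_pow_re, ww_pow_im, ff, sub_mul, Real.cos_sub, pow_add]
  ring

lemma ff_hasSum (r θ : ℝ) (h0 : 0 ≤ r) (h1 : r < 1) : HasSum (ff r θ) (1 / ss r θ) := by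
  have hw : ‖ww r θ‖ < 1 := by rw [norm_ww r θ h0]; exact h1
  set a : ℕ → ℂ := fun k => (uu k : ℂ) * ww r θ ^ k with ha
  have hs : Summable fun k => ‖a k‖ := summable_uu_norm _ hw
  have hs' : Summable fun k => ‖(starRingEnd ℂ) (a k)‖ := by simpa using hs
  have h := summable_mul_of_summable_norm hs hs'
  have hh := (hs.of_norm.hasSum.mul hs'.of_norm.hasSum h)
  have hre := Complex.hasSum_re hh
  have e1 : (∑' k, a k) * (∑' k, (starRingEnd ℂ) (a k)) = ((1 / ss r θ : ℝ) : ℂ) := by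
    rw [← Complex.conj_tsum, Complex.mul_conj, Complex.normSq_eq_norm_sq, sq, ← norm_mul, uu_sq _ hw,
      norm_inv, norm_one_sub_ww, one_div]
  rw [e1, Complex.ofReal_re] at hre
  convert hre using 2
  exact ff_eq r θ _

lemma fourier_hasSum (r θ : ℝ) (h0 : 0 ≤ r) (h1 : r < 1) :
    HasSum (fun j : ℕ => 2 * r ^ (j + 1) * dd r (j + 1) * cos ((j + 1 : ℕ) * θ))
      (1 / ss r θ - dd r 0) := by
  have hf := ff_hasSum r θ h0 h1
  set e : ℕ × ℕ → ℕ × ℕ := fun p => (p.2 + p.1 + 1, p.2) with he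
  set e' : ℕ × ℕ → ℕ × ℕ := fun p => (p.2, p.2 + p.1 + 1) with he'
  set e0 : ℕ → ℕ × ℕ := fun l => (l, l) with he0
  have ie : Function.Injective e := by
    rintro ⟨a, b⟩ ⟨c, d⟩ h; simp [he] at h ⊢; omega
  have ie' : Function.Injective e' := by
    rintro ⟨a, b⟩ ⟨c, d⟩ h; simp [he'] at h ⊢; omega
  have ie0 : Function.Injective e0 := by
    rintro a b h; simpa [he0] using h
  have hse : Summable (ff r θ ∘ e) := hf.summable.comp_injective ie
  have hse' : Summable (ff r θ ∘ e') := hf.summable.comp_injective ie'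
  have hse0 : Summable (ff r θ ∘ e0) := hf.summable.comp_injective ie0
  have heq : ff r θ ∘ e' = ff r θ ∘ e := by
    ext p
    simp only [he, he', Function.comp, ff]
    rw [← Real.cos_neg]
    push_cast
    ring_nf
  -- split
  have hA : HasSum ((Set.range e).indicator (ff r θ)) (∑' p, (ff r θ ∘ e) p) := by
    have := (ie.hasSum_iff (f := (Set.range e).indicator (ff r θ)) (a := ∑' p, (ff r θ ∘ e) p)
      (fun x hx => Set.indicator_of_notMem hx _)).1
    apply this
    convert hse.hasSum using 1
    ext p; simp
  have hB : HasSum ((Set.range e').indicator (ff r θ)) (∑' p, (ff r θ ∘ e) p) := by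
    have := (ie'.hasSum_iff (f := (Set.range e').indicator (ff r θ)) (a := ∑' p, (ff r θ ∘ e) p)
      (fun x hx => Set.indicator_of_notMem hx _)).1
    apply this
    rw [← heq]
    convert hse'.hasSum using 1
    ext p; simp
  have hC : HasSum ((Set.range e0).indicator (ff r θ)) (∑' p, (ff r θ ∘ e0) p) := by
    have := (ie0.hasSum_iff (f := (Set.range e0).indicator (ff r θ)) (a := ∑' p, (ff r θ ∘ e0) p)
      (fun x hx => Set.indicator_of_notMem hx _)).1
    apply this
    convert hse0.hasSum using 1
    ext p; simp
  have hsum := (hA.add hB).add hC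
  have hfe : (fun p => (Set.range e).indicator (ff r θ) p + (Set.range e').indicator (ff r θ) p
      + (Set.range e0).indicator (ff r θ) p) = ff r θ := by
    ext ⟨k, l⟩
    have m1 : (k, l) ∈ Set.range e ↔ l < k := by
      constructor
      · rintro ⟨⟨a, b⟩, h⟩; simp [he] at h; omega
      · intro h; exact ⟨(k - l - 1, l), by simp [he]; omega⟩
    have m2 : (k, l) ∈ Set.range e' ↔ k < l := by
      constructor
      · rintro ⟨⟨a, b⟩, h⟩; simp [he'] at h; omega
      · intro h; exact ⟨(l - k - 1, k), by simp [he']; omega⟩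
    have m3 : (k, l) ∈ Set.range e0 ↔ k = l := by
      constructor
      · rintro ⟨a, h⟩; simp [he0] at h; omega
      · intro h; exact ⟨k, by simp [he0, h]⟩
    simp only [Set.indicator, m1, m2, m3]
    rcases lt_trichotomy k l with h | h | h
    · simp [h, h.ne, h.not_gt]
    · simp [h]
    · simp [h, h.ne', h.not_gt]
  rw [hfe] at hsum
  have h0' : ∑' p, (ff r θ ∘ e0) p = dd r 0 := by
    rw [dd]; congr 1; ext l; simp [he0, ff, two_mul]
  have huniq := hf.unique hsum
  have hfib : ∀ j : ℕ, HasSum (fun l => (ff r θ ∘ e) (j, l))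
      (r ^ (j + 1) * dd r (j + 1) * cos ((j + 1 : ℕ) * θ)) := by
    intro j
    have := ((summable_dd r h0 h1 (j+1)).hasSum.mul_left (r ^ (j+1))).mul_right (cos ((j + 1 : ℕ) * θ))
    refine (my_hasSum_congr fun l => ?_).2 this
    simp only [he, Function.comp, ff]
    push_cast
    rw [show (l:ℝ) + j + 1 - l = j + 1 by ring, show l + (j+1) = l + j + 1 by ring]
    ring
  have hfin := (hse.hasSum.prod_fiberwise hfib).mul_left 2
  have e2 : 2 * ∑' p, (ff r θ ∘ e) p = 1 / ss r θ - dd r 0 := by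
    rw [huniq, h0']; ring
  rw [e2] at hfin
  refine (my_hasSum_congr fun j => ?_).2 hfin
  ring

noncomputable def phase (r : ℝ) (m : ℕ) (θ : ℝ) : ℝ := (m + 1) * θ - Complex.arg (1 - ww r θ)

lemma main_hasSum (r θ : ℝ) (h0 : 0 ≤ r) (h1 : r < 1) (m : ℕ) :
    HasSum (fun k : ℕ => r ^ k * cos ((m + 1 + k : ℕ) * θ)) (cos (phase r m θ) / ss r θ) := by
  have hw : ‖ww r θ‖ < 1 := by rw [norm_ww r θ h0]; exact h1
  have hg := (hasSum_geometric_of_norm_lt_one hw).mul_left (Complex.exp (((m + 1) * θ : ℝ) * Complex.I))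
  have hre := Complex.hasSum_re hg
  convert hre using 1
  · ext k
    rw [Complex.mul_re, ww_pow_re, ww_pow_im, Complex.exp_ofReal_mul_I_re, Complex.exp_ofReal_mul_I_im]
    push_cast
    rw [add_mul ((m:ℝ)+1), Real.cos_add]
    ring
  · have h := Complex.norm_mul_exp_arg_mul_I (1 - ww r θ)
    rw [← h, norm_one_sub_ww, mul_inv, ← Complex.exp_neg, mul_left_comm, ← Complex.exp_add,
      ← Complex.ofReal_inv, Complex.re_ofReal_mul]
    have : ((((m:ℝ) + 1) * θ : ℝ) : ℂ) * Complex.I + -(((1 - ww r θ).arg : ℂ) * Complex.I)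
      = ((phase r m θ : ℝ) : ℂ) * Complex.I := by
      rw [phase]; push_cast; ring
    rw [this, Complex.exp_ofReal_mul_I_re]
    field_simp

noncomputable def qq (r : ℝ) (m : ℕ) : Polynomial ℝ :=
  Polynomial.C (dd r 0) + ∑ j ∈ Finset.range m,
    Polynomial.C (2 * r ^ (j + 1) * dd r (j + 1)) * Polynomial.Chebyshev.T ℝ ((j + 1 : ℕ) : ℤ)

lemma qq_eval (r θ : ℝ) (m : ℕ) : (qq r m).eval (cos θ) =
    dd r 0 + ∑ j ∈ Finset.range m, 2 * r ^ (j + 1) * dd r (j + 1) * cos ((j + 1 : ℕ) * θ) := by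
  rw [qq, Polynomial.eval_add, Polynomial.eval_C, Polynomial.eval_finsetSum]
  congr 1
  apply Finset.sum_congr rfl
  intro j _
  rw [Polynomial.eval_mul, Polynomial.eval_C, Polynomial.Chebyshev.T_real_cos]
  norm_cast

lemma qq_natDegree (r : ℝ) (m : ℕ) : (qq r m).natDegree ≤ m := by
  rw [qq]
  apply Polynomial.natDegree_add_le_of_degree_le
  · simp
  · apply Polynomial.natDegree_sum_le_of_forall_le
    intro j hj
    refine (Polynomial.natDegree_C_mul_le _ _).trans ?_
    rw [Polynomial.Chebyshev.natDegree_T]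
    simp at hj ⊢
    omega

lemma err_bound (r θ : ℝ) (h0 : 0 ≤ r) (h1 : r < 1) (m : ℕ) :
    |(1 - ss r θ * (qq r m).eval (cos θ)) - 2 * r ^ (m + 1) * dd r (m + 1) * cos (phase r m θ)|
      ≤ 4 * r ^ (m + 1) * del r m := by
  have hs := ss_pos r θ h0 h1
  have hF := (hasSum_nat_add_iff' m).2 (fourier_hasSum r θ h0 h1)
  have hM := (main_hasSum r θ h0 h1 m).mul_left (2 * r ^ (m + 1) * dd r (m + 1))
  have hD := hM.sub hF
  have hdel := ((summable_del r h0 h1 m).hasSum).mul_left (2 * r ^ (m+1))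
  have hb : |2 * r ^ (m + 1) * dd r (m + 1) * (cos (phase r m θ) / ss r θ) -
      (1 / ss r θ - dd r 0 - ∑ j ∈ Finset.range m, 2 * r ^ (j + 1) * dd r (j + 1) * cos ((j + 1 : ℕ) * θ))|
      ≤ 2 * r ^ (m + 1) * del r m := by
    have hk : ∀ k : ℕ, ‖2 * r ^ (m + 1) * dd r (m + 1) * (r ^ k * cos ((m + 1 + k : ℕ) * θ)) -
        2 * r ^ (k + m + 1) * dd r (k + m + 1) * cos ((k + m + 1 : ℕ) * θ)‖ ≤
        2 * r ^ (m+1) * (r ^ k * (dd r (m + 1) - dd r (m + 1 + k))) := by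
      intro k
      rw [show k + m + 1 = m + 1 + k by ring, pow_add r (m+1) k]
      have a := dd_anti r h0 h1 (show m + 1 ≤ m + 1 + k by omega)
      have : 2 * r ^ (m + 1) * dd r (m + 1) * (r ^ k * cos ((m + 1 + k : ℕ) * θ)) -
        2 * (r ^ (m + 1) * r ^ k) * dd r (m + 1 + k) * cos ((m + 1 + k : ℕ) * θ)
        = 2 * r ^ (m+1) * (r ^ k * (dd r (m + 1) - dd r (m + 1 + k))) * cos ((m + 1 + k : ℕ) * θ) := by
        ring
      rw [this, norm_mul]
      have nn : 0 ≤ 2 * r ^ (m+1) * (r ^ k * (dd r (m + 1) - dd r (m + 1 + k))) :=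
        mul_nonneg (by positivity) (mul_nonneg (by positivity) (by linarith))
      rw [Real.norm_of_nonneg nn]
      exact mul_le_of_le_one_right nn (Real.abs_cos_le_one _)
    have := tsum_of_norm_bounded hdel hk
    rw [hD.tsum_eq] at this
    exact this
  rw [qq_eval]
  set Q := ∑ j ∈ Finset.range m, 2 * r ^ (j + 1) * dd r (j + 1) * cos ((j + 1 : ℕ) * θ)
  have e : (1 - ss r θ * (dd r 0 + Q)) - 2 * r ^ (m + 1) * dd r (m + 1) * cos (phase r m θ)
     = - (ss r θ * (2 * r ^ (m + 1) * dd r (m + 1) * (cos (phase r m θ) / ss r θ) -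
      (1 / ss r θ - dd r 0 - Q))) := by
    field_simp; ring
  rw [e, abs_neg, abs_mul, abs_of_pos hs]
  calc _ ≤ 2 * (2 * r ^ (m + 1) * del r m) := by
        apply mul_le_mul (ss_le r θ h0 h1) hb (abs_nonneg _) (by norm_num)
    _ = _ := by ring

lemma phase_zero (r : ℝ) (h1 : r < 1) (m : ℕ) : phase r m 0 = 0 := by
  have : (1 - ww r 0) = ((1 - r : ℝ) : ℂ) := by simp [ww]
  rw [phase, this, Complex.arg_ofReal_of_nonneg (by linarith)]; simp

lemma phase_pi (r : ℝ) (h0 : 0 ≤ r) (m : ℕ) : phase r m π = (m + 1) * π := by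
  have : (1 - ww r π) = ((1 + r : ℝ) : ℂ) := by simp [ww]
  rw [phase, this, Complex.arg_ofReal_of_nonneg (by linarith)]; simp

lemma phase_cont (r : ℝ) (h0 : 0 ≤ r) (h1 : r < 1) (m : ℕ) : Continuous (phase r m) := by
  unfold phase
  apply Continuous.sub (by fun_prop)
  rw [continuous_iff_continuousAt]
  intro θ
  have hmem : (1 - ww r θ) ∈ Complex.slitPlane := by
    left
    rw [Complex.sub_re, ww_re, Complex.one_re]
    have := Real.cos_le_one θ
    nlinarith
  apply ContinuousAt.comp (g := Complex.arg) (f := fun θ => 1 - ww r θ) (Complex.continuousAt_arg hmem)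
  unfold ww
  fun_prop

/-- first hitting times -/
lemma exists_hits (f : ℝ → ℝ) (hf : Continuous f) (N : ℕ) (hf0 : f 0 = 0) (hfN : f π = N * π) :
    ∃ t : ℕ → ℝ, ∀ k ≤ N, t k ∈ Icc 0 π ∧ f (t k) = k * π ∧ ∀ j < k, t j < t k := by
  have hex : ∀ k : ℕ, ∃ t, k ≤ N → IsLeast {x | x ∈ Icc 0 π ∧ f x = k * π} t := by
    intro k
    by_cases hk : k ≤ N
    · have hne : ({x | x ∈ Icc 0 π ∧ f x = k * π}).Nonempty := by
        have hiv := intermediate_value_Icc Real.pi_pos.le hf.continuousOn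
        have : (k * π : ℝ) ∈ Icc (f 0) (f π) := by
          rw [hf0, hfN]
          refine ⟨by positivity, ?_⟩
          have : (k:ℝ) ≤ N := by exact_mod_cast hk
          gcongr
        obtain ⟨x, hx, hx'⟩ := hiv this
        exact ⟨x, hx, hx'⟩
      have hc : IsCompact {x | x ∈ Icc 0 π ∧ f x = k * π} :=
        isCompact_Icc.inter_right (isClosed_eq hf continuous_const)
      obtain ⟨t, ht⟩ := hc.exists_isLeast hne
      exact ⟨t, fun _ => ht⟩
    · exact ⟨0, fun h => absurd h hk⟩
  choose t ht using hex
  refine ⟨t, fun k hk => ⟨(ht k hk).1.1, (ht k hk).1.2, fun j hj => ?_⟩⟩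
  have hjN : j ≤ N := by omega
  obtain ⟨⟨hk1, hk2⟩, _⟩ := ht k hk
  have hiv := intermediate_value_Icc hk1.1 hf.continuousOn
  have hjk : (j:ℝ) < k := by exact_mod_cast hj
  have : (j * π : ℝ) ∈ Icc (f 0) (f (t k)) := by
    rw [hf0, hk2]
    refine ⟨by positivity, ?_⟩
    gcongr
  obtain ⟨x, hx, hx'⟩ := hiv this
  have hle : t j ≤ x := (ht j hjN).2 ⟨⟨hx.1, hx.2.trans hk1.2⟩, hx'⟩
  have hne : x ≠ t k := by
    rintro rfl
    rw [hx'] at hk2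
    have := mul_right_cancel₀ Real.pi_pos.ne' hk2
    linarith
  exact lt_of_le_of_lt hle (lt_of_le_of_ne hx.2 hne)

noncomputable def PP (r κ : ℝ) (m : ℕ) : Polynomial ℝ :=
  Polynomial.X * (Polynomial.C (1 / κ) * (qq r m).comp
    (Polynomial.C ((1 + r ^ 2) / (2 * r)) - Polynomial.C (1 / (2 * r * κ ^ 2)) * Polynomial.X ^ 2))

lemma PP_natDegree (r κ : ℝ) (m : ℕ) : (PP r κ m).natDegree ≤ 2 * m + 1 := by
  rw [PP]
  refine Polynomial.natDegree_mul_le.trans ?_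
  rw [Polynomial.natDegree_X]
  have h1 : (Polynomial.C ((1 + r ^ 2) / (2 * r)) -
      Polynomial.C (1 / (2 * r * κ ^ 2)) * Polynomial.X ^ 2 : Polynomial ℝ).natDegree ≤ 2 := by
    refine (Polynomial.natDegree_sub_le _ _).trans ?_
    simp only [Polynomial.natDegree_C]
    refine max_le (by norm_num) (Polynomial.natDegree_C_mul_X_pow_le _ _)
  have h2 := (Polynomial.natDegree_C_mul_le (1 / κ) ((qq r m).comp
    (Polynomial.C ((1 + r ^ 2) / (2 * r)) - Polynomial.C (1 / (2 * r * κ ^ 2)) * Polynomial.X ^ 2)))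
  have h3 := Polynomial.natDegree_comp_le (p := qq r m) (q := Polynomial.C ((1 + r ^ 2) / (2 * r)) -
      Polynomial.C (1 / (2 * r * κ ^ 2)) * Polynomial.X ^ 2)
  have h4 := Nat.mul_le_mul (qq_natDegree r m) h1
  omega

lemma PP_odd (r κ : ℝ) (m : ℕ) (x : ℝ) : (PP r κ m).eval (-x) = - (PP r κ m).eval x := by
  simp [PP]

lemma ss_sq (r θ : ℝ) : ss r θ ^ 2 = 1 - 2 * r * cos θ + r ^ 2 := by
  rw [ss, Real.sq_sqrt]
  have := Real.sin_sq_add_cos_sq θ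
  nlinarith [sq_nonneg (1 - r * cos θ), sq_nonneg (r * sin θ)]

lemma PP_eval (r κ θ : ℝ) (h0 : 0 < r) (hκ : 0 < κ) (m : ℕ) :
    (PP r κ m).eval (κ * ss r θ) = ss r θ * (qq r m).eval (cos θ) := by
  have : (1 + r ^ 2) / (2 * r) - (1 / (2 * r * κ ^ 2)) * (κ * ss r θ) ^ 2 = cos θ := by
    rw [mul_pow, ss_sq]; field_simp; ring
  simp only [PP, Polynomial.eval_mul, Polynomial.eval_X, Polynomial.eval_C, Polynomial.eval_comp,
    Polynomial.eval_sub, Polynomial.eval_pow]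
  rw [this]
  field_simp

lemma ss_strictMono (r : ℝ) (h0 : 0 < r) (h1 : r < 1) {a b : ℝ} (ha : 0 ≤ a) (hb : b ≤ π)
    (hab : a < b) : ss r a < ss r b := by
  have hc := Real.cos_lt_cos_of_nonneg_of_le_pi ha hb hab
  have h := ss_sq r a
  have h' := ss_sq r b
  have := ss_pos r a h0.le h1
  have := ss_pos r b h0.le h1
  apply lt_of_pow_lt_pow_left₀ 2 (by positivity)
  nlinarith

section
variable {A : ℝ}

lemma ss_range (hA : 1 < A) (θ : ℝ) :
    (A + 1) / 2 * ss ((A - 1) / (A + 1)) θ ∈ Icc 1 A := by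
  have hp : 0 < A + 1 := by linarith
  have hsq : ((A + 1) / 2 * ss ((A - 1) / (A + 1)) θ) ^ 2 = ((A ^ 2 + 1) - (A ^ 2 - 1) * cos θ) / 2 := by
    rw [mul_pow, ss_sq]; field_simp; ring
  have h1 : (A - 1) / (A + 1) < 1 := by rw [div_lt_one hp]; linarith
  have h0 : 0 ≤ (A - 1) / (A + 1) := div_nonneg (by linarith) hp.le
  have hs := ss_pos _ θ h0 h1
  have hpos : 0 < (A + 1) / 2 * ss ((A - 1) / (A + 1)) θ := by positivity
  have c1 := Real.cos_le_one θ
  have c2 := Real.neg_one_le_cos θ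
  have hA2 : 0 < A ^ 2 - 1 := by nlinarith
  have d1 := mul_nonneg hA2.le (sub_nonneg.2 c1)
  have d2 := mul_nonneg hA2.le (sub_nonneg.2 c2)
  constructor
  · apply le_of_sq_le_sq _ hpos.le
    rw [hsq]; nlinarith
  · apply le_of_sq_le_sq _ (by linarith)
    rw [hsq]; nlinarith

lemma ss_surj (hA : 1 < A) (x : ℝ) (hx : x ∈ Icc 1 A) :
    ∃ θ, x = (A + 1) / 2 * ss ((A - 1) / (A + 1)) θ := by
  have hp : 0 < A + 1 := by linarith
  have hA2 : 0 < A ^ 2 - 1 := by nlinarith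
  obtain ⟨hx1, hx2⟩ := hx
  refine ⟨Real.arccos ((A ^ 2 + 1 - 2 * x ^ 2) / (A ^ 2 - 1)), ?_⟩
  have hc : cos (Real.arccos ((A ^ 2 + 1 - 2 * x ^ 2) / (A ^ 2 - 1)))
      = (A ^ 2 + 1 - 2 * x ^ 2) / (A ^ 2 - 1) := by
    apply Real.cos_arccos
    · rw [le_div_iff₀ hA2]; nlinarith
    · rw [div_le_one hA2]; nlinarith
  have hsq : ∀ θ, ((A + 1) / 2 * ss ((A - 1) / (A + 1)) θ) ^ 2 = ((A ^ 2 + 1) - (A ^ 2 - 1) * cos θ) / 2 := by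
    intro θ
    rw [mul_pow, ss_sq]; field_simp; ring
  have hs := (ss_range hA (Real.arccos ((A ^ 2 + 1 - 2 * x ^ 2) / (A ^ 2 - 1)))).1
  have h2 := hsq (Real.arccos ((A ^ 2 + 1 - 2 * x ^ 2) / (A ^ 2 - 1)))
  rw [hc, mul_div_cancel₀ _ hA2.ne'] at h2
  have h3 : x ^ 2 = ((A + 1) / 2 * ss ((A - 1) / (A + 1))
      (Real.arccos ((A ^ 2 + 1 - 2 * x ^ 2) / (A ^ 2 - 1)))) ^ 2 := by rw [h2]; ring
  exact (pow_left_inj₀ (by linarith) (by linarith) two_ne_zero).1 h3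

lemma bdd_image (p : Polynomial ℝ) :
    BddAbove ((fun x => |sgn x - p.eval x|) '' (Icc (-A) (-1) ∪ Icc 1 A)) := by
  have hc : IsCompact (Icc (-A) (-1) ∪ Icc 1 A) := isCompact_Icc.union isCompact_Icc
  obtain ⟨M, hM⟩ := hc.exists_bound_of_continuousOn (f := fun x => p.eval x) p.continuous.continuousOn
  refine ⟨1 + M, ?_⟩
  rintro _ ⟨x, hx, rfl⟩
  have h1 := hM x hx
  have h2 : |sgn x| ≤ 1 := by unfold sgn; split_ifs <;> simp
  rw [Real.norm_eq_abs] at h1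
  exact (abs_sub _ _).trans (add_le_add h2 h1)

lemma bestErr_le (hA : 1 < A) (n : ℕ) (U : ℝ) (p : Polynomial ℝ) (hp : p.degree ≤ n)
    (hU : ∀ x ∈ Icc (-A) (-1) ∪ Icc 1 A, |sgn x - p.eval x| ≤ U) : bestErr A A n ≤ U := by
  have hmem : sSup ((fun x => |sgn x - p.eval x|) '' (Icc (-A) (-1) ∪ Icc 1 A)) ∈
      {e : ℝ | ∃ p : Polynomial ℝ, p.degree ≤ (n : ℕ) ∧
        e = sSup ((fun x => |sgn x - p.eval x|) '' (Icc (-A) (-1) ∪ Icc 1 A))} := ⟨p, hp, rfl⟩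
  refine (csInf_le ⟨0, ?_⟩ hmem).trans (csSup_le ?_ ?_)
  · rintro _ ⟨p, _, rfl⟩
    apply Real.sSup_nonneg
    rintro _ ⟨x, _, rfl⟩
    exact abs_nonneg _
  · exact ⟨_, 1, Or.inr ⟨le_rfl, hA.le⟩, rfl⟩
  · rintro _ ⟨x, hx, rfl⟩
    exact hU x hx

lemma le_bestErr (n : ℕ) (V : ℝ)
    (hV : ∀ p : Polynomial ℝ, p.degree ≤ n →
      ∃ x ∈ Icc (-A) (-1) ∪ Icc 1 A, V ≤ |sgn x - p.eval x|) : V ≤ bestErr A A n := by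
  apply le_csInf
  · exact ⟨_, 0, by simp, rfl⟩
  · rintro _ ⟨p, hp, rfl⟩
    obtain ⟨x, hx, h⟩ := hV p hp
    exact h.trans (le_csSup (bdd_image p) ⟨x, hx, rfl⟩)

lemma upper (hA : 1 < A) (m : ℕ) : bestErr A A (2 * m + 1) ≤
    2 * ((A - 1) / (A + 1)) ^ (m + 1) *
      (dd ((A - 1) / (A + 1)) (m + 1) + 2 * del ((A - 1) / (A + 1)) m) := by
  have hp : 0 < A + 1 := by linarith
  set r := (A - 1) / (A + 1) with hr
  have h1 : r < 1 := by rw [hr, div_lt_one hp]; linarith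
  have h0 : 0 < r := div_pos (by linarith) hp
  have key : ∀ x ∈ Icc 1 A, |1 - (PP r ((A + 1) / 2) m).eval x| ≤
      2 * r ^ (m + 1) * (dd r (m + 1) + 2 * del r m) := by
    intro x hx
    obtain ⟨θ, rfl⟩ := ss_surj hA x hx
    rw [PP_eval r _ θ h0 (by positivity) m]
    have hb := err_bound r θ h0.le h1 m
    have hd := dd_nonneg r h0.le (m+1)
    have hc : |2 * r ^ (m + 1) * dd r (m + 1) * cos (phase r m θ)| ≤ 2 * r ^ (m + 1) * dd r (m + 1) := by
      rw [abs_mul, abs_of_nonneg (by positivity)]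
      exact mul_le_of_le_one_right (by positivity) (Real.abs_cos_le_one _)
    have := abs_sub_abs_le_abs_sub (1 - ss r θ * (qq r m).eval (cos θ))
      (2 * r ^ (m + 1) * dd r (m + 1) * cos (phase r m θ))
    linarith
  apply bestErr_le hA _ _ (PP r ((A + 1) / 2) m)
  · exact Polynomial.natDegree_le_iff_degree_le.1 (PP_natDegree _ _ _)
  · rintro x (hx | hx)
    · have h := key (-x) ⟨by linarith [hx.2], by linarith [hx.1]⟩
      have hx' : x < 0 := by linarith [hx.2]
      rw [PP_odd] at h
      rw [sgn, if_pos hx', ← abs_neg]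
      convert h using 2
      ring
    · rw [sgn, if_neg (by linarith [hx.1])]
      exact key x hx

lemma poly_contra (P : Polynomial ℝ) (m : ℕ) (hP : P.natDegree ≤ 2 * m + 1) (x : ℕ → ℝ)
    (hx0 : 0 < x 0) (hx : ∀ k ≤ m, x k < x (k + 1))
    (hs : ∀ k ≤ m + 1, 0 < (-1) ^ k * (P.eval (x k) - P.eval (-x k))) : False := by
  set R : Polynomial ℝ := P - P.comp (-Polynomial.X) with hR
  have hRe : ∀ y, R.eval y = P.eval y - P.eval (-y) := by intro y; simp [hR]
  have hRd : R.natDegree ≤ 2 * m + 1 := by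
    refine (Polynomial.natDegree_sub_le _ _).trans (max_le hP ?_)
    refine Polynomial.natDegree_comp_le.trans ?_
    simpa using hP
  have hne : R ≠ 0 := by
    intro h
    have := hs 0 (by omega)
    rw [← hRe, h] at this
    simp at this
  have hroot : ∀ k : ℕ, ∃ y, k ≤ m → x k < y ∧ y < x (k + 1) ∧ R.eval y = 0 := by
    intro k
    by_cases hk : k ≤ m
    · have ha := hs k (by omega)
      have hb := hs (k + 1) (by omega)
      rw [← hRe] at ha hb
      have hle := (hx k hk).le
      rw [pow_succ] at hb
      rcases neg_one_pow_eq_or ℝ k with e | e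
      · rw [e] at ha hb
        obtain ⟨y, hy, hy0⟩ := intermediate_value_Ioo' hle R.continuous.continuousOn
          (show (0:ℝ) ∈ Ioo _ _ from ⟨by linarith, by linarith⟩)
        exact ⟨y, fun _ => ⟨hy.1, hy.2, hy0⟩⟩
      · rw [e] at ha hb
        obtain ⟨y, hy, hy0⟩ := intermediate_value_Ioo hle R.continuous.continuousOn
          (show (0:ℝ) ∈ Ioo _ _ from ⟨by linarith, by linarith⟩)
        exact ⟨y, fun _ => ⟨hy.1, hy.2, hy0⟩⟩
    · exact ⟨0, fun h => absurd h hk⟩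
  choose y hy using hroot
  have hxm : ∀ k j, j ≤ k → k ≤ m + 1 → x j ≤ x k := by
    intro k j hjk
    induction k, hjk using Nat.le_induction with
    | base => intro _; exact le_rfl
    | succ k hk ih => intro h; exact (ih (by omega)).trans (hx k (by omega)).le
  have hymono : ∀ j k, j < k → k ≤ m → y j < y k := by
    intro j k hjk hk
    have a := (hy j (by omega)).2.1
    have b := (hy k hk).1
    have c := hxm k (j + 1) hjk (by omega)
    linarith
  have hypos : ∀ k ≤ m, 0 < y k := by
    intro k hk
    have a := (hy k hk).1
    have c := hxm k 0 (by omega) (by omega)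
    linarith
  have hyinj : ∀ j k, j ≤ m → k ≤ m → y j = y k → j = k := by
    intro j k hj hk h
    rcases lt_trichotomy j k with h' | h' | h'
    · exact absurd h (hymono j k h' hk).ne
    · exact h'
    · exact absurd h (hymono k j h' hj).ne'
  apply hne
  apply Polynomial.eq_zero_of_natDegree_lt_card_of_eval_eq_zero R
    (ι := Fin (m + 1) ⊕ Fin (m + 1)) (f := Sum.elim (fun i => y i) (fun i => - y i))
  · rintro (i | i) (j | j) h
    · simp only [Sum.elim_inl] at h
      have := hyinj i j (by omega) (by omega) h
      congr 1; ext; exact this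
    · simp only [Sum.elim_inl, Sum.elim_inr] at h
      have := hypos i (by omega); have := hypos j (by omega); linarith
    · simp only [Sum.elim_inl, Sum.elim_inr] at h
      have := hypos i (by omega); have := hypos j (by omega); linarith
    · simp only [Sum.elim_inr, neg_inj] at h
      have := hyinj i j (by omega) (by omega) h
      congr 1; ext; exact this
  · rintro (i | i)
    · exact (hy i (by omega)).2.2
    · have := (hy i (by omega)).2.2
      rw [hRe] at this
      simp only [Sum.elim_inr]
      rw [hRe, neg_neg]; linarith
  · simp; omega

lemma lower (hA : 1 < A) (m : ℕ) : 2 * ((A - 1) / (A + 1)) ^ (m + 1) *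
      (dd ((A - 1) / (A + 1)) (m + 1) - 2 * del ((A - 1) / (A + 1)) m) ≤ bestErr A A (2 * m + 1) := by
  have hp : 0 < A + 1 := by linarith
  set r := (A - 1) / (A + 1) with hr
  have h1 : r < 1 := by rw [hr, div_lt_one hp]; linarith
  have h0 : 0 < r := div_pos (by linarith) hp
  apply le_bestErr
  intro p hpd
  by_contra! hcon
  set V := 2 * r ^ (m + 1) * (dd r (m + 1) - 2 * del r m) with hV
  obtain ⟨t, ht⟩ := exists_hits (phase r m) (phase_cont r h0.le h1 m) (m + 1)
    (phase_zero r h1 m) (by rw [phase_pi r h0.le m]; push_cast; ring)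
  set Q := PP r ((A + 1) / 2) m with hQ
  have hmem : ∀ k, (A + 1) / 2 * ss r (t k) ∈ Icc 1 A := fun k => ss_range hA (t k)
  apply poly_contra (p - Q) m (x := fun k => (A + 1) / 2 * ss r (t k))
  · refine (Polynomial.natDegree_sub_le _ _).trans (max_le ?_ (PP_natDegree _ _ _))
    exact Polynomial.natDegree_le_iff_degree_le.2 hpd
  · have := (hmem 0).1; linarith
  · intro k hk
    have a := (ht k (by omega)).1
    obtain ⟨b, _, c⟩ := ht (k + 1) (by omega)
    have := ss_strictMono r h0 h1 a.1 b.2 (c k (by omega))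
    have : 0 < (A + 1) / 2 := by positivity
    gcongr
  · intro k hk
    have hm := hmem k
    have hQe := PP_eval r ((A + 1) / 2) (t k) h0 (by positivity) m
    have hb := err_bound r (t k) h0.le h1 m
    rw [← hQe, (ht k hk).2.1, Real.cos_nat_mul_pi] at hb
    have c1 := hcon _ (Or.inr hm)
    have c2 := hcon (-((A + 1) / 2 * ss r (t k))) (Or.inl ⟨by linarith [hm.2], by linarith [hm.1]⟩)
    rw [sgn, if_neg (by linarith [hm.1])] at c1
    rw [sgn, if_pos (by linarith [hm.1])] at c2
    set X := (A + 1) / 2 * ss r (t k)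
    simp only [Polynomial.eval_sub]
    rw [PP_odd]
    rw [← hQ] at hb ⊢
    rw [abs_lt] at c1 c2
    rw [abs_le] at hb
    have hV' : V = 2 * r ^ (m + 1) * dd r (m + 1) - 4 * r ^ (m + 1) * del r m := by rw [hV]; ring
    rcases neg_one_pow_eq_or ℝ k with e | e
    · rw [e] at hb ⊢
      linarith [hb.1, c1.1, c1.2, c2.1, c2.2]
    · rw [e] at hb ⊢
      linarith [hb.2, c1.1, c1.2, c2.1, c2.2]

end

theorem symmetric_case_asymptotics (A : ℝ) (hA : 1 < A) :
    Tendsto (fun m : ℕ =>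
        Real.sqrt (2 * m + 1) * ((A + 1) / (A - 1)) ^ m * (Real.sqrt A / (A - 1)) *
          bestErr A A (2 * m + 1))
      atTop (nhds (Real.sqrt (2 / π))) := by
  have hp : 0 < A + 1 := by linarith
  have hm1 : 0 < A - 1 := by linarith
  set r := (A - 1) / (A + 1) with hr
  have h1 : r < 1 := by rw [hr, div_lt_one hp]; linarith
  have h0 : 0 < r := div_pos (by linarith) hp
  have hinv : (A + 1) / (A - 1) = r⁻¹ := by rw [hr, inv_div]
  have hsA : 0 < √A := Real.sqrt_pos.2 (by linarith)
  have hsq : √(1 - r ^ 2) = 2 * √A / (A + 1) := by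
    have : 1 - r ^ 2 = (2 * √A / (A + 1)) ^ 2 := by
      have hA' : √A ^ 2 = A := Real.sq_sqrt (by linarith)
      rw [hr]; field_simp; rw [hA']; ring
    rw [this, Real.sqrt_sq (by positivity)]
  have hlim : ∀ c : ℝ, Tendsto (fun m : ℕ => (√A / (A - 1)) * (2 * r) *
      (√(2 * m + 1) * dd r (m + 1) + c * (√(2 * m + 1) * del r m))) atTop (nhds √(2 / π)) := by
    intro c
    have h := ((dd_tendsto r h0.le h1 1).add ((del_tendsto r h0.le h1).const_mul c)).const_mul
      ((√A / (A - 1)) * (2 * r))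
    convert h using 2
    rw [hsq, hr]
    field_simp
    ring
  refine tendsto_of_tendsto_of_tendsto_of_le_of_le (hlim (-2)) (hlim 2) (fun m => ?_) (fun m => ?_)
  · have h := lower hA m
    rw [← hr] at h
    have hc : 0 ≤ √(2 * m + 1) * ((A + 1) / (A - 1)) ^ m * (√A / (A - 1)) := by positivity
    refine le_trans (le_of_eq ?_) (mul_le_mul_of_nonneg_left h hc)
    rw [hinv, inv_pow, pow_succ]
    field_simp
    ring
  · have h := upper hA m
    rw [← hr] at h
    have hc : 0 ≤ √(2 * m + 1) * ((A + 1) / (A - 1)) ^ m * (√A / (A - 1)) := by positivity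
    refine le_trans (mul_le_mul_of_nonneg_left h hc) (le_of_eq ?_)
    rw [hinv, inv_pow, pow_succ]
    field_simp
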